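/- arXiv:2402.13833 — 2 statements merged into one kernel-verified Lean document; each statement's English description precedes it below -/
import Mathlib

section
/- Let M be a finitely generated R-module that is Gorenstein projective as an R-module. Then there exists a short exact sequence of S-modules 0 → P → G →^{φ} M → 0 in which P is a finitely generated projective S-module and G is a finitely generated Gorenstein projective S-module; in particular, φ: G → M is a Gorenstein projective precover of M over S. -/
open CategoryTheory LinearMap Function

/-- A module `M` over a commutative ring `A` is *Gorenstein projective* if the biduality
map `M → Hom_A(Hom_A(M,A),A)` is an isomorphism and
`Ext^i_A(M,A) = 0 = Ext^i_A(Hom_A(M,A),A)` for all `i ≥ 1`. -/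
noncomputable def IsGP (A : Type) [CommRing A] (M : Type) [AddCommGroup M] [Module A M] : Prop :=
  Function.Bijective (Module.Dual.eval A M) ∧
  (∀ i : ℕ, 0 < i →
    Subsingleton (((Ext A (ModuleCat A) i).obj
      (Opposite.op (ModuleCat.of A M))).obj (ModuleCat.of A A))) ∧
  (∀ i : ℕ, 0 < i →
    Subsingleton (((Ext A (ModuleCat A) i).obj
      (Opposite.op (ModuleCat.of A (Module.Dual A M)))).obj (ModuleCat.of A A)))

/-- `f : G1 → G0` is an object of the monomorphism category `Mon(ω, 𝒢)`:
`G1`, `G0` are finitely generated Gorenstein projective `S`-modules, `f` is injective,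
and `ω · Coker f = 0` (i.e. `ω • y ∈ range f` for all `y`). -/
def MonObj (S : Type) [CommRing S] (ω : S) {G1 G0 : Type}
    [AddCommGroup G1] [Module S G1] [AddCommGroup G0] [Module S G0]
    (f : G1 →ₗ[S] G0) : Prop :=
  Module.Finite S G1 ∧ Module.Finite S G0 ∧ IsGP S G1 ∧ IsGP S G0 ∧
  Function.Injective f ∧ ∀ y : G0, ω • y ∈ LinearMap.range f

section ExtComputation
open CategoryTheory Limits

variable {A : Type} [CommRing A] {N : Type} [AddCommGroup N] [Module A N]
  (X : ℕ → Type) [∀ k, AddCommGroup (X k)] [∀ k, Module A (X k)]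
  (d : ∀ k, X (k + 1) →ₗ[A] X k) (π : X 0 →ₗ[A] N)

/-- The chain complex of modules attached to a sequence of linear maps. -/
noncomputable def seqComplex (hd : ∀ k, d k ∘ₗ d (k + 1) = 0) : ChainComplex (ModuleCat.{0} A) ℕ :=
  ChainComplex.of (fun k => ModuleCat.of A (X k)) (fun k => ModuleCat.ofHom (d k))
    (fun k => by rw [← ModuleCat.ofHom_comp, hd k]; rfl)

theorem seqComplex_d (hd : ∀ k, d k ∘ₗ d (k + 1) = 0) (k : ℕ) :
    (seqComplex X d hd).d (k + 1) k = ModuleCat.ofHom (d k) :=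
  ChainComplex.of_d (fun k => ModuleCat.of A (X k)) (fun k => ModuleCat.ofHom (d k)) k

theorem seqComplex_exactAt (hd : ∀ k, d k ∘ₗ d (k + 1) = 0)
    (hex : ∀ k x, d k x = 0 → ∃ y, d (k + 1) y = x) (n : ℕ) :
    (seqComplex X d hd).ExactAt (n + 1) := by
  rw [HomologicalComplex.exactAt_iff' _ (n + 1 + 1) (n + 1) n (by simp) (by simp)]
  rw [ShortComplex.moduleCat_exact_iff]
  change ∀ x : X (n+1), ((seqComplex X d hd).d (n + 1) n) x = 0 →
    ∃ y : X (n+1+1), ((seqComplex X d hd).d (n + 1 + 1) (n+1)) y = x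
  rw [seqComplex_d, seqComplex_d]
  exact hex n

theorem seqComplex_aug (hd : ∀ k, d k ∘ₗ d (k + 1) = 0) (hd0 : π ∘ₗ d 0 = 0) :
    (seqComplex X d hd).d 1 0 ≫ ModuleCat.ofHom π = 0 := by
  change (seqComplex X d hd).d (0 + 1) 0 ≫ ModuleCat.ofHom π = 0
  rw [seqComplex_d]
  change ModuleCat.ofHom (π ∘ₗ d 0) = 0
  rw [hd0]; rfl

/-- The projective resolution attached to an exact sequence. -/
noncomputable def seqResolution [∀ k, Module.Projective A (X k)]
    (hd : ∀ k, d k ∘ₗ d (k + 1) = 0)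
    (hex : ∀ k x, d k x = 0 → ∃ y, d (k + 1) y = x)
    (hd0 : π ∘ₗ d 0 = 0) (hex0 : ∀ x, π x = 0 → ∃ y, d 0 y = x)
    (hπ : Function.Surjective π) : ProjectiveResolution (ModuleCat.of A N) where
  complex := seqComplex X d hd
  projective := fun n => by
    change Projective (ModuleCat.of A (X n))
    infer_instance
  π := (ChainComplex.toSingle₀Equiv _ _).symm ⟨ModuleCat.ofHom π, seqComplex_aug X d π hd hd0⟩
  quasiIso := ⟨fun n => by
    cases n
    · rw [ChainComplex.quasiIsoAt₀_iff, ShortComplex.quasiIso_iff_of_zeros']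
      · constructor
        · rw [ShortComplex.moduleCat_exact_iff]
          intro x hx
          have hx' : π x = 0 := by
            have := ChainComplex.toSingle₀Equiv_symm_apply_f_zero (C := seqComplex X d hd)
              (ModuleCat.ofHom π) (seqComplex_aug X d π hd hd0)
            have h2 := congrArg (fun f => f.hom x) this
            exact h2.symm.trans hx
          obtain ⟨y, hy⟩ := hex0 x hx'
          refine ⟨y, ?_⟩
          change ((seqComplex X d hd).d (0+1) 0) y = x
          rw [seqComplex_d]; exact hy
        · rw [ModuleCat.epi_iff_surjective]
          intro z
          obtain ⟨x, hx⟩ := hπ z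
          refine ⟨x, ?_⟩
          have := ChainComplex.toSingle₀Equiv_symm_apply_f_zero (C := seqComplex X d hd)
              (ModuleCat.ofHom π) (seqComplex_aug X d π hd hd0)
          have h2 := congrArg (fun f => f.hom x) this
          exact h2.trans hx
      all_goals rfl
    · rw [quasiIsoAt_iff_exactAt']
      · apply seqComplex_exactAt X d hd hex
      · apply ChainComplex.exactAt_succ_single_obj⟩

theorem ext_iff_seq [∀ k, Module.Projective A (X k)]
    (hd : ∀ k, d k ∘ₗ d (k + 1) = 0)
    (hex : ∀ k x, d k x = 0 → ∃ y, d (k + 1) y = x)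
    (hd0 : π ∘ₗ d 0 = 0) (hex0 : ∀ x, π x = 0 → ∃ y, d 0 y = x)
    (hπ : Function.Surjective π) :
    (∀ i : ℕ, 0 < i →
    Subsingleton (((Ext A (ModuleCat A) i).obj
      (Opposite.op (ModuleCat.of A N))).obj (ModuleCat.of A A))) ↔
    ∀ k, ∀ f : X (k + 1) →ₗ[A] A, f ∘ₗ d (k + 1) = 0 → ∃ g : X k →ₗ[A] A, g ∘ₗ d k = f := by
  have key : ∀ n : ℕ, Subsingleton (((Ext A (ModuleCat A) (n+1)).obj
      (Opposite.op (ModuleCat.of A N))).obj (ModuleCat.of A A)) ↔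
      ∀ f : X (n + 1) →ₗ[A] A, f ∘ₗ d (n + 1) = 0 → ∃ g : X n →ₗ[A] A, g ∘ₗ d n = f := by
    intro n
    let P := seqResolution X d π hd hex hd0 hex0 hπ
    rw [← ModuleCat.isZero_iff_subsingleton, (P.isoExt (R := A) (n+1) (ModuleCat.of A A)).isZero_iff,
      ← HomologicalComplex.exactAt_iff_isZero_homology,
      HomologicalComplex.exactAt_iff' _ n (n + 1) (n + 1 + 1) (by simp) (by simp),
      ShortComplex.moduleCat_exact_iff]
    change (∀ x : (ModuleCat.of A (X (n+1)) ⟶ ModuleCat.of A A),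
      ((seqComplex X d hd).d (n+1+1) (n+1)) ≫ x = 0 →
      ∃ y : (ModuleCat.of A (X n) ⟶ ModuleCat.of A A),
      ((seqComplex X d hd).d (n+1) n) ≫ y = x) ↔ _
    rw [seqComplex_d, seqComplex_d]
    constructor
    · intro h f hf
      obtain ⟨y, hy⟩ := h (ModuleCat.ofHom f) (by
        apply ModuleCat.hom_ext; exact hf)
      exact ⟨y.hom, congrArg ModuleCat.Hom.hom hy⟩
    · intro h x hx
      obtain ⟨g, hg⟩ := h x.hom (congrArg ModuleCat.Hom.hom hx)
      exact ⟨ModuleCat.ofHom g, ModuleCat.hom_ext hg⟩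
  constructor
  · intro h k
    exact (key k).1 (h (k+1) k.succ_pos)
  · intro h i hi
    obtain ⟨k, rfl⟩ := Nat.exists_eq_succ_of_ne_zero hi.ne'
    exact (key k).2 (h k)

end ExtComputation
section MatrixComplexes
open Matrix

/-- Exactness of the pair of matrices `(P, Q)`: `ker P = range Q`. -/
def MEx {A : Type} [CommRing A] {l m n : Type} [Fintype m] [Fintype n]
    (P : Matrix l m A) (Q : Matrix m n A) : Prop :=
  ∀ x, P *ᵥ x = 0 ↔ ∃ y, Q *ᵥ y = x

theorem MEx.mul_eq_zero {A : Type} [CommRing A] {l m n : Type} [Fintype m] [Fintype n]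
    {P : Matrix l m A} {Q : Matrix m n A} (h : MEx P Q) : P * Q = 0 := by
  classical
  apply Matrix.ext_of_mulVec_single
  intro i
  rw [← Matrix.mulVec_mulVec, Matrix.zero_mulVec]
  exact (h _).2 ⟨_, rfl⟩

theorem exists_dot {A : Type} [CommRing A] {m : Type} [Fintype m] (f : (m → A) →ₗ[A] A) :
    ∃ w : m → A, ∀ x, f x = w ⬝ᵥ x := by
  classical
  refine ⟨fun i => f (Pi.single i 1), fun x => ?_⟩
  rw [LinearMap.pi_apply_eq_sum_univ f x]
  simp only [dotProduct, smul_eq_mul]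
  refine Finset.sum_congr rfl fun i _ => ?_
  rw [mul_comm]
  congr 2
  ext j
  simp [Pi.single_apply, eq_comm]

theorem dot_mulVec_tr {A : Type} [CommRing A] {m n : Type} [Fintype m] [Fintype n]
    (Q : Matrix m n A) (w : m → A) (x : n → A) : w ⬝ᵥ (Q *ᵥ x) = (Qᵀ *ᵥ w) ⬝ᵥ x := by
  rw [Matrix.dotProduct_mulVec, Matrix.mulVec_transpose]

theorem eq_zero_of_dot {A : Type} [CommRing A] {m : Type} [Fintype m]
    (w : m → A) (h : ∀ x, w ⬝ᵥ x = 0) : w = 0 :=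
  dotProduct_eq_zero w h

/-- The functional attached to a vector. -/
def dotL {A : Type} [CommRing A] {m : Type} [Fintype m] (w : m → A) : (m → A) →ₗ[A] A where
  toFun x := w ⬝ᵥ x
  map_add' x y := dotProduct_add w x y
  map_smul' c x := dotProduct_smul c w x

theorem ext_iff_mat {A : Type} [CommRing A] {N : Type} [AddCommGroup N] [Module A N]
    (ι : ℕ → Type) [∀ k, Fintype (ι k)] (D : ∀ k, Matrix (ι k) (ι (k + 1)) A)
    (π : (ι 0 → A) →ₗ[A] N) (hex : ∀ k, MEx (D k) (D (k + 1)))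
    (hex0 : ∀ x, π x = 0 ↔ ∃ y, D 0 *ᵥ y = x) (hπ : Function.Surjective π) :
    (∀ i : ℕ, 0 < i →
    Subsingleton (((Ext A (ModuleCat A) i).obj
      (Opposite.op (ModuleCat.of A N))).obj (ModuleCat.of A A))) ↔
    ∀ k, MEx (D (k + 1))ᵀ (D k)ᵀ := by
  rw [ext_iff_seq (fun k => ι k → A) (fun k => (D k).mulVecLin) π]
  · constructor
    · intro h k x
      constructor
      · intro hx
        obtain ⟨g, hg⟩ := h k (dotL x) (by
          ext y
          change x ⬝ᵥ (D (k+1) *ᵥ _) = 0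
          rw [dot_mulVec_tr, hx, zero_dotProduct])
        obtain ⟨w, hw⟩ := exists_dot g
        refine ⟨w, ?_⟩
        rw [← sub_eq_zero]
        apply eq_zero_of_dot
        intro z
        have := LinearMap.congr_fun hg z
        change g (D k *ᵥ z) = x ⬝ᵥ z at this
        rw [sub_dotProduct, ← this, hw, dot_mulVec_tr, sub_self]
      · rintro ⟨y, rfl⟩
        rw [Matrix.mulVec_mulVec, ← Matrix.transpose_mul, (hex k).mul_eq_zero]
        simp
    · intro h k f hf
      obtain ⟨w, hw⟩ := exists_dot f
      obtain ⟨y, hy⟩ := (h k w).1 (by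
        apply eq_zero_of_dot
        intro z
        rw [← dot_mulVec_tr, ← hw]
        exact LinearMap.congr_fun hf z)
      refine ⟨dotL y, ?_⟩
      apply LinearMap.ext
      intro z
      change y ⬝ᵥ (D k *ᵥ z) = f z
      rw [hw, dot_mulVec_tr, hy]
  · intro k
    rw [← Matrix.mulVecLin_mul, (hex k).mul_eq_zero, Matrix.mulVecLin_zero]
  · intro k x hx
    exact (hex k x).1 hx
  · apply LinearMap.ext
    intro x
    exact (hex0 _).2 ⟨x, rfl⟩
  · intro x hx
    exact (hex0 x).1 hx
  · exact hπ

theorem exists_mulVec_range {A : Type} [CommRing A] [IsNoetherianRing A] {n : ℕ}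
    (K : Submodule A (Fin n → A)) :
    ∃ (m : ℕ) (Q : Matrix (Fin n) (Fin m) A), ∀ x, x ∈ K ↔ ∃ y, Q *ᵥ y = x := by
  obtain ⟨m, f, hf⟩ := Module.Finite.exists_fin' A K
  refine ⟨m, LinearMap.toMatrix' (K.subtype ∘ₗ f), fun x => ?_⟩
  simp only [LinearMap.toMatrix'_mulVec]
  constructor
  · intro hx
    obtain ⟨y, hy⟩ := hf ⟨x, hx⟩
    exact ⟨y, by simp [hy]⟩
  · rintro ⟨y, rfl⟩
    exact (f y).2

theorem exists_res (A : Type) [CommRing A] [IsNoetherianRing A] (N : Type) [AddCommGroup N]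
    [Module A N] [Module.Finite A N] :
    ∃ (n : ℕ → ℕ) (D : ∀ k, Matrix (Fin (n k)) (Fin (n (k + 1))) A)
      (π : (Fin (n 0) → A) →ₗ[A] N), (∀ k, MEx (D k) (D (k + 1))) ∧
      (∀ x, π x = 0 ↔ ∃ y, D 0 *ᵥ y = x) ∧ Function.Surjective π := by
  obtain ⟨n0, π, hπ⟩ := Module.Finite.exists_fin' A N
  choose m Q hQ using fun (n : ℕ) (K : Submodule A (Fin n → A)) => exists_mulVec_range K
  let st : ℕ → (Σ n : ℕ, Submodule A (Fin n → A)) := fun k =>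
    Nat.rec ⟨n0, LinearMap.ker π⟩ (fun _ p => ⟨m p.1 p.2, LinearMap.ker (Q p.1 p.2).mulVecLin⟩) k
  refine ⟨fun k => (st k).1, fun k => Q (st k).1 (st k).2, π, ?_, ?_, hπ⟩
  · intro k x
    rw [← hQ]
    rfl
  · intro x
    exact hQ n0 (LinearMap.ker π) x

theorem exists_factor {A : Type} [CommRing A] {U V W : Type} [AddCommGroup U] [AddCommGroup V]
    [AddCommGroup W] [Module A U] [Module A V] [Module A W] (f : U →ₗ[A] V) (g : U →ₗ[A] W)
    (hf : Function.Surjective f) (h : ∀ x, f x = 0 → g x = 0) :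
    ∃ t : V →ₗ[A] W, ∀ x, t (f x) = g x := by
  refine ⟨(LinearMap.ker f).liftQ g h ∘ₗ (f.quotKerEquivOfSurjective hf).symm.toLinearMap, ?_⟩
  intro x
  have : (f.quotKerEquivOfSurjective hf).symm (f x) = (LinearMap.ker f).mkQ x := by
    rw [LinearEquiv.symm_apply_eq]; rfl
  rw [LinearMap.comp_apply, LinearEquiv.coe_coe, this]
  exact Submodule.liftQ_apply _ _ _

/-- A (spliced) totally acyclic complex gives a Gorenstein projective module. -/
theorem isGP_of_complex {A : Type} [CommRing A] (ι κ : ℕ → Type) [∀ k, Fintype (ι k)]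
    [∀ k, Fintype (κ k)] (D : ∀ k, Matrix (ι k) (ι (k + 1)) A)
    (E : ∀ k, Matrix (κ k) (κ (k + 1)) A) (C : Matrix (κ 0) (ι 0) A)
    (hD : ∀ k, MEx (D k) (D (k + 1))) (hD' : ∀ k, MEx (D (k + 1))ᵀ (D k)ᵀ)
    (hE : ∀ k, MEx (E k) (E (k + 1))) (hE' : ∀ k, MEx (E (k + 1))ᵀ (E k)ᵀ)
    (hC1 : MEx C (D 0)) (hC2 : MEx (D 0)ᵀ Cᵀ) (hC3 : MEx Cᵀ (E 0)) (hC4 : MEx (E 0)ᵀ C) :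
    IsGP A (LinearMap.range C.mulVecLin) := by
  let G := LinearMap.range C.mulVecLin
  let π : (ι 0 → A) →ₗ[A] G := C.mulVecLin.rangeRestrict
  have hπ : Function.Surjective π := LinearMap.surjective_rangeRestrict _
  have hπv : ∀ x, ((π x : G) : κ 0 → A) = C *ᵥ x := fun x => rfl
  let ρ : (κ 0 → A) →ₗ[A] Module.Dual A G :=
    { toFun := fun y => dotL y ∘ₗ G.subtype
      map_add' := fun x y => by ext g; exact add_dotProduct x y _
      map_smul' := fun c y => by ext g; exact smul_dotProduct c y _ }
  have hρv : ∀ y (g : G), ρ y g = y ⬝ᵥ (g : κ 0 → A) := fun y g => rfl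
  have hρ : Function.Surjective ρ := by
    intro f
    obtain ⟨w, hw⟩ := exists_dot (f ∘ₗ π)
    obtain ⟨y, hy⟩ := (hC2 w).1 (by
      apply eq_zero_of_dot
      intro z
      rw [← dot_mulVec_tr, ← hw]
      have : π (D 0 *ᵥ z) = 0 := Subtype.ext ((hC1 _).2 ⟨z, rfl⟩)
      rw [LinearMap.comp_apply, this, map_zero])
    refine ⟨y, ?_⟩
    apply LinearMap.ext
    intro g
    obtain ⟨x, rfl⟩ := hπ g
    rw [hρv, hπv, dot_mulVec_tr, hy, ← hw]
    rfl
  have hρ0 : ∀ y, ρ y = 0 ↔ ∃ z, E 0 *ᵥ z = y := by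
    intro y
    rw [← hC3 y]
    constructor
    · intro h
      apply eq_zero_of_dot
      intro x
      rw [← dot_mulVec_tr, ← hπv, ← hρv, h]
      rfl
    · intro h
      apply LinearMap.ext
      intro g
      obtain ⟨x, rfl⟩ := hπ g
      rw [hρv, hπv, dot_mulVec_tr, h, zero_dotProduct]
      rfl
  refine ⟨⟨?_, ?_⟩, ?_, ?_⟩
  · rw [injective_iff_map_eq_zero]
    intro g hg
    apply Subtype.ext
    apply eq_zero_of_dot
    intro y
    have := LinearMap.congr_fun hg (ρ y)
    rw [dotProduct_comm]
    exact this
  · intro θ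
    obtain ⟨z, hz⟩ := exists_dot (θ ∘ₗ ρ)
    obtain ⟨x, hx⟩ := (hC4 z).1 (by
      apply eq_zero_of_dot
      intro t
      rw [← dot_mulVec_tr, ← hz, LinearMap.comp_apply, (hρ0 _).2 ⟨t, rfl⟩, map_zero])
    refine ⟨π x, ?_⟩
    apply LinearMap.ext
    intro f
    obtain ⟨y, rfl⟩ := hρ f
    change ρ y (π x) = (θ ∘ₗ ρ) y
    rw [hz, hρv, hπv, hx, dotProduct_comm]
  · refine (ext_iff_mat ι D π hD (fun x => ?_) hπ).2 hD'
    rw [← hC1 x, ← hπv]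
    exact Subtype.ext_iff
  · exact (ext_iff_mat κ E ρ hE hρ0 hρ).2 hE'

/-- A Gorenstein projective module has a (spliced) totally acyclic complex. -/
theorem complex_of_isGP {A : Type} [CommRing A] [IsNoetherianRing A] (M : Type) [AddCommGroup M]
    [Module A M] [Module.Finite A M] (h : IsGP A M) :
    ∃ (n m : ℕ → ℕ) (D : ∀ k, Matrix (Fin (n k)) (Fin (n (k + 1))) A)
      (E : ∀ k, Matrix (Fin (m k)) (Fin (m (k + 1))) A) (C : Matrix (Fin (m 0)) (Fin (n 0)) A)
      (π : (Fin (n 0) → A) →ₗ[A] M),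
      (∀ k, MEx (D k) (D (k + 1))) ∧ (∀ k, MEx (D (k + 1))ᵀ (D k)ᵀ) ∧
      (∀ k, MEx (E k) (E (k + 1))) ∧ (∀ k, MEx (E (k + 1))ᵀ (E k)ᵀ) ∧
      MEx C (D 0) ∧ MEx (D 0)ᵀ Cᵀ ∧ MEx Cᵀ (E 0) ∧ MEx (E 0)ᵀ C ∧
      Function.Surjective π ∧ ∀ x, π x = 0 ↔ ∃ y, D 0 *ᵥ y = x := by
  obtain ⟨hb, he, he'⟩ := h
  obtain ⟨n, D, π, hD, hπ0, hπ⟩ := exists_res A M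
  obtain ⟨m, E, ρ, hE, hρ0, hρ⟩ := exists_res A (Module.Dual A M)
  have hD' := (ext_iff_mat (fun k => Fin (n k)) D π hD hπ0 hπ).1 he
  have hE' := (ext_iff_mat (fun k => Fin (m k)) E ρ hE hρ0 hρ).1 he'
  let C : Matrix (Fin (m 0)) (Fin (n 0)) A :=
    Matrix.of fun j i => ρ (Pi.single j 1) (π (Pi.single i 1))
  have hC : ∀ x y, y ⬝ᵥ (C *ᵥ x) = ρ y (π x) := by
    let f1 : (Fin (m 0) → A) →ₗ[A] (Fin (n 0) → A) →ₗ[A] A := Matrix.toLinearMap₂' A C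
    have hf : f1 = (LinearMap.lcomp A A π) ∘ₗ ρ := by
      ext j i
      simp [f1, C, Matrix.toLinearMap₂'_apply']
    intro x y
    have := LinearMap.congr_fun (LinearMap.congr_fun hf y) x
    simpa [f1, Matrix.toLinearMap₂'_apply'] using this
  refine ⟨n, m, D, E, C, π, hD, hD', hE, hE', ?_, ?_, ?_, ?_, hπ, hπ0⟩
  · intro x
    rw [← hπ0]
    constructor
    · intro hx
      apply hb.1
      rw [map_zero]
      apply LinearMap.ext
      intro f
      obtain ⟨y, rfl⟩ := hρ f
      change ρ y (π x) = 0
      rw [← hC, hx, dotProduct_zero]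
    · intro hx
      apply eq_zero_of_dot
      intro y
      rw [dotProduct_comm, hC, hx, map_zero]
  · intro w
    constructor
    · intro hw
      obtain ⟨f, hf⟩ := exists_factor π (dotL w) hπ (by
        intro x hx
        obtain ⟨y, rfl⟩ := (hπ0 x).1 hx
        change w ⬝ᵥ (D 0 *ᵥ y) = 0
        rw [dot_mulVec_tr, hw, zero_dotProduct])
      obtain ⟨y, hy⟩ := hρ f
      refine ⟨y, ?_⟩
      rw [← sub_eq_zero]
      apply eq_zero_of_dot
      intro z
      rw [sub_dotProduct, ← dot_mulVec_tr, hC, hy, hf]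
      exact sub_self _
    · rintro ⟨y, rfl⟩
      apply eq_zero_of_dot
      intro z
      rw [← dot_mulVec_tr, ← dot_mulVec_tr, hC, (hπ0 _).2 ⟨z, rfl⟩, map_zero]
  · intro y
    rw [← hρ0]
    constructor
    · intro hy
      apply LinearMap.ext
      intro g
      obtain ⟨x, rfl⟩ := hπ g
      rw [← hC, dot_mulVec_tr, hy, zero_dotProduct]
      rfl
    · intro hy
      apply eq_zero_of_dot
      intro x
      rw [← dot_mulVec_tr, hC, hy]
      rfl
  · intro z
    constructor
    · intro hz
      obtain ⟨θ, hθ⟩ := exists_factor ρ (dotL z) hρ (by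
        intro y hy
        obtain ⟨t, rfl⟩ := (hρ0 y).1 hy
        change z ⬝ᵥ (E 0 *ᵥ t) = 0
        rw [dot_mulVec_tr, hz, zero_dotProduct])
      obtain ⟨g, hg⟩ := hb.2 θ
      obtain ⟨x, rfl⟩ := hπ g
      refine ⟨x, ?_⟩
      rw [← sub_eq_zero]
      apply eq_zero_of_dot
      intro y
      rw [sub_dotProduct, dotProduct_comm, hC]
      have h1 := hθ y
      rw [← hg] at h1
      change ρ y (π x) = z ⬝ᵥ y at h1
      rw [h1, sub_self]
    · rintro ⟨x, rfl⟩
      apply eq_zero_of_dot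
      intro t
      rw [← dot_mulVec_tr, dotProduct_comm, hC, (hρ0 _).2 ⟨t, rfl⟩]
      rfl

end MatrixComplexes
section Lifting
open Matrix

variable {S : Type} [CommRing S] {ω : S}

theorem exists_smul_of_mk {m : Type} (x : m → S)
    (hx : ∀ i, Ideal.Quotient.mk (Ideal.span {ω}) (x i) = 0) : ∃ w : m → S, x = ω • w := by
  have : ∀ i, ∃ c, x i = ω * c := by
    intro i
    have := hx i
    rw [Ideal.Quotient.eq_zero_iff_mem, Ideal.mem_span_singleton] at this
    exact this
  choose w hw using this
  exact ⟨w, funext hw⟩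

theorem smul_cancel_vec (hreg : ω ∈ nonZeroDivisors S) {m : Type} {x y : m → S}
    (h : ω • x = ω • y) : x = y := by
  funext i
  have := congrFun h i
  exact (mul_cancel_left_mem_nonZeroDivisors hreg).1 this

theorem mk_omega : Ideal.Quotient.mk (Ideal.span {ω}) ω = 0 :=
  Ideal.Quotient.eq_zero_iff_mem.2 (Ideal.mem_span_singleton_self ω)

theorem mk_mulVec {m n : Type} [Fintype n] (L : Matrix m n S) (x : n → S) :
    (fun i => Ideal.Quotient.mk (Ideal.span {ω}) ((L *ᵥ x) i)) =
      (L.map (Ideal.Quotient.mk (Ideal.span {ω}))) *ᵥ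
        (fun i => Ideal.Quotient.mk (Ideal.span {ω}) (x i)) := by
  funext i
  exact RingHom.map_mulVec _ L x i

theorem exact_lift {l m n : Type} [Fintype m] [Fintype n] (L : Matrix l m S) (L' : Matrix m n S)
    (h : MEx (L.map (Ideal.Quotient.mk (Ideal.span {ω})))
      (L'.map (Ideal.Quotient.mk (Ideal.span {ω}))))
    (x : m → S) (y : l → S) (hxy : L *ᵥ x = ω • y) :
    ∃ z w, x = L' *ᵥ z + ω • w := by
  obtain ⟨z', hz'⟩ := (h (fun i => Ideal.Quotient.mk _ (x i))).1 (by
    rw [← mk_mulVec, hxy]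
    funext i
    simp [mk_omega])
  choose z hz using fun i => Ideal.Quotient.mk_surjective (z' i)
  obtain rfl : (fun i => Ideal.Quotient.mk _ (z i)) = z' := funext hz
  obtain ⟨w, hw⟩ := exists_smul_of_mk (ω := ω) (x - L' *ᵥ z) (by
    intro i
    rw [← mk_mulVec] at hz'
    have := congrFun hz' i
    rw [Pi.sub_apply, map_sub, sub_eq_zero]
    exact this.symm)
  exact ⟨z, w, by rw [← hw]; abel⟩

theorem exists_lift_complex (hreg : ω ∈ nonZeroDivisors S) {I : Type} (s : I → I) (n : I → ℕ)
    (D : ∀ i, Matrix (Fin (n i)) (Fin (n (s i))) (S ⧸ Ideal.span {ω}))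
    (h : ∀ i, D i * D (s i) = 0) :
    ∃ (L : ∀ i, Matrix (Fin (n i)) (Fin (n (s i))) S)
      (H : ∀ i, Matrix (Fin (n i)) (Fin (n (s (s i)))) S),
      (∀ i, (L i).map (Ideal.Quotient.mk (Ideal.span {ω})) = D i) ∧
      (∀ i, L i * L (s i) = ω • H i) ∧ (∀ i, H i * L (s (s i)) = L i * H (s i)) := by
  choose L hL using fun i a b => Ideal.Quotient.mk_surjective (D i a b)
  have hL' : ∀ i, (Matrix.of (L i)).map (Ideal.Quotient.mk (Ideal.span {ω})) = D i := by
    intro i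
    ext a b
    exact hL i a b
  have h2 : ∀ i a b, ∃ c, (Matrix.of (L i) * Matrix.of (L (s i))) a b = ω * c := by
    intro i a b
    rw [← dvd_def, ← Ideal.mem_span_singleton, ← Ideal.Quotient.eq_zero_iff_mem]
    have := h i
    rw [← hL' i, ← hL' (s i), ← Matrix.map_mul] at this
    exact congrFun (congrFun this a) b
  choose H hH using h2
  have hH' : ∀ i, Matrix.of (L i) * Matrix.of (L (s i)) = ω • Matrix.of (H i) := by
    intro i
    ext a b
    exact hH i a b
  refine ⟨fun i => Matrix.of (L i), fun i => Matrix.of (H i), hL', hH', ?_⟩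
  intro i
  ext a b
  have : ω • (Matrix.of (H i) * Matrix.of (L (s (s i)))) =
      ω • (Matrix.of (L i) * Matrix.of (H (s i))) := by
    rw [← Matrix.smul_mul, ← Matrix.mul_smul, ← hH', ← hH', Matrix.mul_assoc]
  exact (mul_cancel_left_mem_nonZeroDivisors hreg).1 (congrFun (congrFun this a) b)

variable {I : Type} (s : I → I) (n : I → ℕ) (ω)
    (L : ∀ i, Matrix (Fin (n i)) (Fin (n (s i))) S)
    (H : ∀ i, Matrix (Fin (n i)) (Fin (n (s (s i)))) S)

/-- The differential of the cone-type complex over `S`. -/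
def coneD (i : I) : Matrix (Fin (n (s i)) ⊕ Fin (n i)) (Fin (n (s (s i))) ⊕ Fin (n (s i))) S :=
  Matrix.fromBlocks (L (s i)) (ω • (1 : Matrix (Fin (n (s i))) (Fin (n (s i))) S)) (-H i) (-L i)

theorem coneD_mulVec (i : I) (x : Fin (n (s (s i))) → S) (y : Fin (n (s i)) → S) :
    coneD ω s n L H i *ᵥ Sum.elim x y =
      Sum.elim (L (s i) *ᵥ x + ω • y) (-(H i *ᵥ x) - L i *ᵥ y) := by
  rw [coneD, Matrix.fromBlocks_mulVec]
  simp [Matrix.smul_mulVec, Matrix.neg_mulVec, sub_eq_add_neg]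

theorem coneD_tr_mulVec (i : I) (x : Fin (n (s i)) → S) (y : Fin (n i) → S) :
    (coneD ω s n L H i)ᵀ *ᵥ Sum.elim x y =
      Sum.elim ((L (s i))ᵀ *ᵥ x - (H i)ᵀ *ᵥ y) (ω • x - (L i)ᵀ *ᵥ y) := by
  rw [coneD, Matrix.fromBlocks_transpose, Matrix.fromBlocks_mulVec]
  simp [Matrix.smul_mulVec, Matrix.neg_mulVec, sub_eq_add_neg]

theorem coneD_mul (hLL : ∀ i, L i * L (s i) = ω • H i)
    (hHL : ∀ i, H i * L (s (s i)) = L i * H (s i)) (i : I) :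
    coneD ω s n L H i * coneD ω s n L H (s i) = 0 := by
  rw [coneD, coneD, Matrix.fromBlocks_multiply, ← Matrix.fromBlocks_zero]
  congr 1
  · simp [hLL]
  · simp
  · simp [hHL]
  · simp [hLL]

theorem coneD_exact (hreg : ω ∈ nonZeroDivisors S) (hLL : ∀ i, L i * L (s i) = ω • H i)
    (hHL : ∀ i, H i * L (s (s i)) = L i * H (s i)) (i : I)
    (h : MEx ((L (s i)).map (Ideal.Quotient.mk (Ideal.span {ω})))
      ((L (s (s i))).map (Ideal.Quotient.mk (Ideal.span {ω})))) :
    MEx (coneD ω s n L H i) (coneD ω s n L H (s i)) := by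
  intro v
  constructor
  · intro hv
    obtain ⟨x, y, rfl⟩ : ∃ x y, v = Sum.elim x y := ⟨_, _, (Sum.elim_comp_inl_inr v).symm⟩
    rw [coneD_mulVec] at hv
    have h1 : L (s i) *ᵥ x + ω • y = 0 := by
      funext a
      exact congrFun hv (Sum.inl a)
    have h1' : L (s i) *ᵥ x = ω • (-y) := by
      rw [smul_neg]; exact eq_neg_of_add_eq_zero_left h1
    obtain ⟨z, w, rfl⟩ := exact_lift _ _ h x _ h1'
    refine ⟨Sum.elim z w, ?_⟩
    rw [coneD_mulVec]
    congr 1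
    apply smul_cancel_vec hreg
    rw [Matrix.mulVec_add, Matrix.mulVec_mulVec, hLL, Matrix.smul_mulVec, Matrix.mulVec_smul,
      smul_neg] at h1'
    rw [← neg_inj, ← h1', smul_sub, smul_neg]
    abel
  · rintro ⟨y, rfl⟩
    rw [Matrix.mulVec_mulVec, coneD_mul ω s n L H hLL hHL, Matrix.zero_mulVec]

theorem coneD_exact_tr (hreg : ω ∈ nonZeroDivisors S) (hLL : ∀ i, L i * L (s i) = ω • H i)
    (hHL : ∀ i, H i * L (s (s i)) = L i * H (s i)) (i : I)
    (h : MEx ((L (s i))ᵀ.map (Ideal.Quotient.mk (Ideal.span {ω})))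
      ((L i)ᵀ.map (Ideal.Quotient.mk (Ideal.span {ω})))) :
    MEx (coneD ω s n L H (s i))ᵀ (coneD ω s n L H i)ᵀ := by
  intro v
  constructor
  · intro hv
    obtain ⟨a, b, rfl⟩ : ∃ x y, v = Sum.elim x y := ⟨_, _, (Sum.elim_comp_inl_inr v).symm⟩
    rw [coneD_tr_mulVec] at hv
    have h1 : ω • a - (L (s i))ᵀ *ᵥ b = 0 := by
      funext t
      exact congrFun hv (Sum.inr t)
    have h1' : (L (s i))ᵀ *ᵥ b = ω • a := (sub_eq_zero.1 h1).symm
    obtain ⟨c, e, rfl⟩ := exact_lift _ _ h b _ h1'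
    refine ⟨Sum.elim e (-c), ?_⟩
    rw [coneD_tr_mulVec]
    congr 1
    · apply smul_cancel_vec hreg
      rw [Matrix.mulVec_add, Matrix.mulVec_mulVec, ← Matrix.transpose_mul, hLL,
        Matrix.transpose_smul, Matrix.smul_mulVec, Matrix.mulVec_smul] at h1'
      rw [← h1', smul_sub, Matrix.mulVec_neg, smul_neg]
      abel
    · rw [Matrix.mulVec_neg]
      abel
  · rintro ⟨y, rfl⟩
    rw [Matrix.mulVec_mulVec, ← Matrix.transpose_mul, coneD_mul ω s n L H hLL hHL]
    simp

end Lifting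

section Index
open Matrix

/-- Successor function on `ℤ`, by pattern matching. -/
def nxt : ℤ → ℤ
  | Int.ofNat k => Int.ofNat (k + 1)
  | Int.negSucc 0 => Int.ofNat 0
  | Int.negSucc (k + 1) => Int.negSucc k

/-- Ranks of the spliced complex. -/
def splN (n m : ℕ → ℕ) : ℤ → ℕ
  | Int.ofNat 0 => m 0
  | Int.ofNat (k + 1) => n k
  | Int.negSucc k => m (k + 1)

/-- Differentials of the spliced complex. -/
def splD {A : Type} (n m : ℕ → ℕ) (D : ∀ k, Matrix (Fin (n k)) (Fin (n (k + 1))) A)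
    (E : ∀ k, Matrix (Fin (m k)) (Fin (m (k + 1))) A) (C : Matrix (Fin (m 0)) (Fin (n 0)) A) :
    ∀ i : ℤ, Matrix (Fin (splN n m i)) (Fin (splN n m (nxt i))) A
  | Int.ofNat 0 => C
  | Int.ofNat (k + 1) => D k
  | Int.negSucc 0 => (E 0)ᵀ
  | Int.negSucc (k + 1) => (E (k + 1))ᵀ

/-- A free-valued map extension property of Gorenstein projective modules. -/
theorem precover_lift {S : Type} [CommRing S] [IsNoetherianRing S] {p : ℕ} {G M G' : Type}
    [AddCommGroup G] [Module S G] [AddCommGroup M] [Module S M] [AddCommGroup G'] [Module S G']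
    (g : (Fin p → S) →ₗ[S] G) (φ : G →ₗ[S] M) (hg : Function.Injective g)
    (hex : Function.Exact g φ) (hφ : Function.Surjective φ)
    (hfin : Module.Finite S G') (hG' : IsGP S G') (u : G' →ₗ[S] M) :
    ∃ v : G' →ₗ[S] G, φ ∘ₗ v = u := by
  obtain ⟨n, D, π, hD, hπ0, hπ⟩ := exists_res S G'
  have hD' := (ext_iff_mat (fun k => Fin (n k)) D π hD hπ0 hπ).1 hG'.2.1
  obtain ⟨t, ht⟩ := Module.projective_lifting_property φ (u ∘ₗ π) hφ
  have ht' : ∀ x, φ (t x) = u (π x) := fun x => LinearMap.congr_fun ht x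
  -- the map `t ∘ D 0` factors through `g`
  have h1 : ∀ y, ∃ z, g z = t (D 0 *ᵥ y) := by
    intro y
    refine (hex _).1 ?_
    rw [ht', (hπ0 _).2 ⟨y, rfl⟩, map_zero]
  choose c hc using h1
  let c' : (Fin (n 1) → S) →ₗ[S] (Fin p → S) :=
    { toFun := c
      map_add' := fun x y => hg (by rw [map_add, hc, hc, hc, Matrix.mulVec_add, map_add])
      map_smul' := fun a x => hg (by
        rw [map_smul, hc, hc, Matrix.mulVec_smul, map_smul, RingHom.id_apply]) }
  have hc' : ∀ y, g (c' y) = t (D 0 *ᵥ y) := hc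
  have h2 : ∀ j : Fin p, ∃ w : Fin (n 0) → S, ∀ y, w ⬝ᵥ (D 0 *ᵥ y) = c' y j := by
    intro j
    obtain ⟨w, hw⟩ := exists_dot (LinearMap.proj j ∘ₗ c')
    obtain ⟨z, hz⟩ := (hD' 0 w).1 (by
      apply eq_zero_of_dot
      intro y
      rw [← dot_mulVec_tr, ← hw]
      have : c' (D (0 + 1) *ᵥ y) = 0 := by
        apply hg
        rw [hc', (hD 0 _).2 ⟨y, rfl⟩, map_zero, map_zero]
      rw [LinearMap.comp_apply, this, map_zero])
    refine ⟨z, fun y => ?_⟩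
    rw [dot_mulVec_tr, hz, ← hw]
    rfl
  choose w hw using h2
  let W : (Fin (n 0) → S) →ₗ[S] (Fin p → S) := LinearMap.pi fun j => dotL (w j)
  have hW : ∀ y, W (D 0 *ᵥ y) = c' y := fun y => funext fun j => hw j y
  obtain ⟨v, hv⟩ := exists_factor π (t - g ∘ₗ W) hπ (by
    intro x hx
    obtain ⟨y, rfl⟩ := (hπ0 x).1 hx
    rw [LinearMap.sub_apply, LinearMap.comp_apply, hW, hc', sub_self])
  refine ⟨v, ?_⟩
  apply LinearMap.ext
  intro z
  obtain ⟨x, rfl⟩ := hπ z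
  rw [LinearMap.comp_apply, hv, LinearMap.sub_apply, map_sub, ht', LinearMap.comp_apply,
    hex.apply_apply_eq_zero, sub_zero]

end Index
section Sequence
open Matrix

theorem cone_sequence {S : Type} [CommRing S] (ω : S) (hreg : ω ∈ nonZeroDivisors S)
    {M : Type} [AddCommGroup M] [Module (S ⧸ Ideal.span {ω}) M] [Module S M]
    [IsScalarTower S (S ⧸ Ideal.span {ω}) M]
    {I : Type} (s : I → I) (N : I → ℕ)
    (L : ∀ i, Matrix (Fin (N i)) (Fin (N (s i))) S)
    (H : ∀ i, Matrix (Fin (N i)) (Fin (N (s (s i)))) S) (p : I)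
    (hX : MEx (coneD ω s N L H p) (coneD ω s N L H (s p)))
    (π : (Fin (N (s (s p))) → S ⧸ Ideal.span {ω}) →ₗ[S ⧸ Ideal.span {ω}] M)
    (hπ : Function.Surjective π)
    (hπ0 : ∀ x, π x = 0 ↔
      ∃ y, (L (s (s p))).map (Ideal.Quotient.mk (Ideal.span {ω})) *ᵥ y = x) :
    ∃ (g : (Fin (N (s p)) → S) →ₗ[S] LinearMap.range (coneD ω s N L H p).mulVecLin)
      (φ : LinearMap.range (coneD ω s N L H p).mulVecLin →ₗ[S] M),
      Function.Injective g ∧ Function.Exact g φ ∧ Function.Surjective φ := by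
  let Q := coneD ω s N L H p
  let q := Q.mulVecLin.rangeRestrict
  have hq : Function.Surjective q := LinearMap.surjective_rangeRestrict _
  have hqv : ∀ x, (q x : _ → S) = Q.mulVec x := fun x => rfl
  -- the map to `M`
  let red : (Fin (N (s (s p))) → S) →ₗ[S] M :=
    { toFun := fun x => π (fun i => Ideal.Quotient.mk _ (x i))
      map_add' := fun x y => by rw [← map_add]; rfl
      map_smul' := fun c x => by
        rw [RingHom.id_apply, ← algebraMap_smul (S ⧸ Ideal.span {ω}) c (π _), ← map_smul]
        rfl }
  let Φ : (Fin (N (s (s p))) ⊕ Fin (N (s p)) → S) →ₗ[S] M := red ∘ₗ LinearMap.funLeft S S Sum.inl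
  have hΦv : ∀ (a : Fin (N (s (s p))) → S) (b : Fin (N (s p)) → S), Φ (Sum.elim a b) =
    π (fun i => Ideal.Quotient.mk _ (a i)) := fun a b => rfl
  have hLz : ∀ (z : Fin (N (s (s (s p)))) → S) (w : Fin (N (s (s p))) → S),
      π (fun i => Ideal.Quotient.mk _ (((L (s (s p))).mulVec z + ω • w) i)) = 0 := by
    intro z w
    rw [hπ0]
    refine ⟨fun i => Ideal.Quotient.mk _ (z i), ?_⟩
    have h1 := mk_mulVec (ω := ω) (L (s (s p))) z
    refine Eq.trans h1.symm ?_
    funext i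
    simp [mk_omega]
  obtain ⟨φ, hφ⟩ := exists_factor q Φ hq (by
    intro x hx
    have hx' : Q.mulVec x = 0 := by rw [← hqv, hx]; rfl
    obtain ⟨y, rfl⟩ := (hX x).1 hx'
    obtain ⟨z, w, rfl⟩ : ∃ z w, y = Sum.elim z w := ⟨_, _, (Sum.elim_comp_inl_inr y).symm⟩
    have h2 := coneD_mulVec ω s N L H (s p) z w
    refine (congrArg Φ h2).trans ?_
    exact (hΦv _ _).trans (hLz z w))
  let inr : (Fin (N (s p)) → S) →ₗ[S] (Fin (N (s (s p))) ⊕ Fin (N (s p)) → S) :=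
    { toFun := fun b => Sum.elim 0 b
      map_add' := fun x y => by
        funext t
        rcases t with t | t
        · exact (add_zero 0).symm
        · rfl
      map_smul' := fun c x => by
        funext t
        rcases t with t | t
        · exact (mul_zero c).symm
        · rfl }
  let g : (Fin (N (s p)) → S) →ₗ[S] LinearMap.range Q.mulVecLin := q ∘ₗ inr
  have hgq : ∀ b, g b = q (Sum.elim 0 b) := fun b => rfl
  have hginj : Function.Injective g := by
    intro x y hxy
    have h1 : Q.mulVec (Sum.elim 0 x) = Q.mulVec (Sum.elim 0 y) := congrArg Subtype.val hxy
    have h2 : ∀ b, Q.mulVec (Sum.elim 0 b) = _ :=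
      fun b => coneD_mulVec ω s N L H p 0 b
    apply smul_cancel_vec hreg
    funext t
    have h3 := congrFun (((h2 x).symm.trans h1).trans (h2 y)) (Sum.inl t)
    simpa [Matrix.mulVec_zero] using h3
  have hφs : Function.Surjective φ := by
    intro z
    obtain ⟨x, rfl⟩ := hπ z
    choose a ha using fun i => Ideal.Quotient.mk_surjective (x i)
    refine ⟨q (Sum.elim a 0), ?_⟩
    rw [hφ, hΦv]
    exact congrArg π (funext ha)
  have hexact : Function.Exact g φ := by
    intro z
    constructor
    · intro hz
      obtain ⟨v, rfl⟩ := hq z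
      obtain ⟨a, b, rfl⟩ : ∃ a b, v = Sum.elim a b := ⟨_, _, (Sum.elim_comp_inl_inr v).symm⟩
      rw [hφ] at hz
      obtain ⟨y, hy⟩ := (hπ0 _).1 ((hΦv a b).symm.trans hz)
      choose x hx using fun i => Ideal.Quotient.mk_surjective (y i)
      obtain rfl : (fun i => Ideal.Quotient.mk _ (x i)) = y := funext hx
      obtain ⟨w, hw⟩ := exists_smul_of_mk (ω := ω) (a - (L (s (s p))).mulVec x) (by
        intro i
        have h1 := mk_mulVec (ω := ω) (L (s (s p))) x
        have h2 := congrFun (h1.trans hy) i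
        rw [Pi.sub_apply, map_sub, sub_eq_zero]
        exact h2.symm)
      have ha : a = (L (s (s p))).mulVec x + ω • w := by rw [← hw]; abel
      have h2 := coneD_mulVec ω s N L H (s p) x w
      let b' : Fin (N (s p)) → S := -((H (s p)).mulVec x) - (L (s p)).mulVec w
      have h3 : q (Sum.elim a b') = 0 := by
        apply Subtype.ext
        rw [ha]
        exact (hX _).2 ⟨Sum.elim x w, h2⟩
      refine ⟨b - b', ?_⟩
      rw [hgq]
      have h4 : (Sum.elim 0 (b - b') : Fin (N (s (s p))) ⊕ Fin (N (s p)) → S) =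
          Sum.elim a b - Sum.elim a b' := by
        funext t
        rcases t with t | t
        · exact (sub_self _).symm
        · rfl
      rw [h4]
      refine (map_sub q _ _).trans ?_
      rw [h3, sub_zero]
    · rintro ⟨b, rfl⟩
      rw [hgq, hφ, hΦv]
      refine Eq.trans (congrArg π ?_) (map_zero π)
      funext i
      exact map_zero _
  exact ⟨g, φ, hginj, hexact, hφs⟩

end Sequence

/-- every finitely generated Gorenstein projective `R`-module `M`
(where `R = S/(ω)`) fits in a short exact sequence of `S`-modules `0 → P → G → M → 0`
with `P` finitely generated projective and `G` finitely generated Gorenstein projective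
over `S`; in particular `G → M` is a Gorenstein projective precover over `S`. -/
theorem stmt_12 (S : Type) [CommRing S] [IsNoetherianRing S] [IsLocalRing S]
    (ω : S) (hω : ω ∈ IsLocalRing.maximalIdeal S) (hreg : ω ∈ nonZeroDivisors S)
    (M : Type) [AddCommGroup M] [Module (S ⧸ Ideal.span {ω}) M] [Module S M]
    [IsScalarTower S (S ⧸ Ideal.span {ω}) M]
    (hfin : Module.Finite (S ⧸ Ideal.span {ω}) M)
    (hgp : IsGP (S ⧸ Ideal.span {ω}) M) :
    ∃ (P G : ModuleCat.{0} S),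
      Module.Finite S P ∧ Module.Projective S P ∧
      Module.Finite S G ∧ IsGP S G ∧
      ∃ (g : P →ₗ[S] G) (φ : G →ₗ[S] M),
        Function.Injective g ∧ Function.Exact g φ ∧ Function.Surjective φ ∧
        ∀ (G' : ModuleCat.{0} S), Module.Finite S G' → IsGP S G' →
          ∀ u : G' →ₗ[S] M, ∃ v : G' →ₗ[S] G, φ ∘ₗ v = u := by
  have hnoeth : IsNoetherianRing (S ⧸ Ideal.span {ω}) := inferInstance
  obtain ⟨n, m, D, E, C, π, hD, hD', hE, hE', hC1, hC2, hC3, hC4, hπ, hπ0⟩ :=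
    complex_of_isGP M hgp
  let N := splN n m
  let T := splD n m D E C
  have hT : ∀ i, MEx (T i) (T (nxt i)) := by
    intro i
    match i with
    | Int.ofNat 0 => exact hC1
    | Int.ofNat (k + 1) => exact hD k
    | Int.negSucc 0 => exact hC4
    | Int.negSucc 1 => exact hE' 0
    | Int.negSucc (k + 2) => exact hE' (k + 1)
  have hT' : ∀ i, MEx (T (nxt i)).transpose (T i).transpose := by
    intro i
    match i with
    | Int.ofNat 0 => exact hC2
    | Int.ofNat (k + 1) => exact hD' k
    | Int.negSucc 0 => exact hC3
    | Int.negSucc 1 => exact hE 0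
    | Int.negSucc (k + 2) => exact hE (k + 1)
  obtain ⟨L, H, hL, hLL, hHL⟩ := exists_lift_complex hreg nxt N T (fun i => (hT i).mul_eq_zero)
  let X := coneD ω nxt N L H
  have hX : ∀ i, MEx (X i) (X (nxt i)) := fun i =>
    coneD_exact ω nxt N L H hreg hLL hHL i (by rw [hL, hL]; exact hT _)
  have hX' : ∀ i, MEx (X (nxt i)).transpose (X i).transpose := fun i =>
    coneD_exact_tr ω nxt N L H hreg hLL hHL i (by
      rw [Matrix.transpose_map, Matrix.transpose_map, hL, hL]; exact hT' _)
  let Q := X (Int.negSucc 0)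
  have hG : IsGP S (LinearMap.range Q.mulVecLin) :=
    isGP_of_complex (fun k => Fin (N (nxt (Int.ofNat k))) ⊕ Fin (N (Int.ofNat k)))
      (fun k => Fin (N (nxt (Int.negSucc k))) ⊕ Fin (N (Int.negSucc k)))
      (fun k => X (Int.ofNat k)) (fun k => (X (Int.negSucc (k + 1))).transpose) Q
      (fun k => hX (Int.ofNat k)) (fun k => hX' (Int.ofNat k))
      (fun k => hX' (Int.negSucc (k + 2))) (fun k => hX (Int.negSucc (k + 2)))
      (hX (Int.negSucc 0)) (hX' (Int.negSucc 0)) (hX' (Int.negSucc 1)) (hX (Int.negSucc 1))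
  obtain ⟨g, φ, hginj, hexact, hφs⟩ := cone_sequence ω hreg nxt N L H (Int.negSucc 0)
    (hX (Int.negSucc 0)) π hπ (by
      rw [hL]
      exact hπ0)
  refine ⟨ModuleCat.of S (Fin (m 0) → S), ModuleCat.of S (LinearMap.range Q.mulVecLin),
    inferInstanceAs (Module.Finite S (Fin (m 0) → S)),
    inferInstanceAs (Module.Projective S (Fin (m 0) → S)),
    inferInstanceAs (Module.Finite S (LinearMap.range Q.mulVecLin)), hG, g, φ, hginj, hexact, hφs,
    ?_⟩
  intro G' hfin' hG' u
  exact precover_lift g φ hginj hexact hφs hfin' hG' u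
end

section
/- Let 0 → M' →^{f} M →^{g} M'' → 0 be a short exact sequence of finitely generated R-modules, each Gorenstein projective as an R-module. Let 0 → P →^{l} G →^{π} M → 0 and 0 → P'' →^{l''} G'' →^{π''} M'' → 0 be short exact sequences of S-modules with P, P'' finitely generated projective S-modules, G, G'' finitely generated Gorenstein projective S-modules, and π'' a Gorenstein projective precover of M''. Then there exist a finitely generated projective S-module P', a finitely generated Gorenstein projective S-module G', a short exact sequence of S-modules 0 → P' → G' →^{π'} M' → 0, and an S-linear map h: G → G'' with π''∘h = g∘π, fitting into a commutative 3×3 diagram with exact rows and columns whose rows are 0 → P' → P'' ⊕ P → P'' → 0, 0 → G' → P'' ⊕ G → G'' → 0 (with second map [l'' h]), and 0 → M' → M → M'' → 0, and whose columns are the three given/constructed short exact sequences; in particular π': G' → M' is a Gorenstein projective precover of M' with projective kernel, and 0 → (P' → G') → (P'' ⊕ P → P'' ⊕ G) → (P'' → G'') → 0 is a short exact sequence in Mon(ω,𝒢). -/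
open CategoryTheory LinearMap Function

theorem ext_bridge (A : Type) [CommRing A] (X Y : ModuleCat.{0} A) (n : ℕ) :
    Subsingleton (((Ext A (ModuleCat A) (n+1)).obj (Opposite.op X)).obj Y) ↔
      Subsingleton (Abelian.Ext X Y (n+1)) := by
  let P := projectiveResolution X
  have h1 : Subsingleton (((Ext A (ModuleCat A) (n+1)).obj (Opposite.op X)).obj Y) ↔
      ∀ x : P.complex.X (n+1) ⟶ Y, P.complex.d (n+2) (n+1) ≫ x = 0 →
        ∃ y : P.complex.X n ⟶ Y, P.complex.d (n+1) n ≫ y = x := by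
    rw [← ModuleCat.isZero_iff_subsingleton, (P.isoExt (R := A) (n+1) Y).isZero_iff,
      ← HomologicalComplex.exactAt_iff_isZero_homology,
      HomologicalComplex.exactAt_iff' _ n (n+1) (n+2) (by simp) (by simp),
      ShortComplex.moduleCat_exact_iff]
    rfl
  rw [h1]
  constructor
  · intro h
    refine subsingleton_of_forall_eq 0 fun α => ?_
    obtain ⟨f, hf, rfl⟩ := P.extMk_surjective α (n+2) rfl
    rw [P.extMk_eq_zero_iff f (n+2) rfl hf n rfl]
    exact h f hf
  · intro h x hx
    exact (P.extMk_eq_zero_iff x (n+2) rfl hx n rfl).1 (Subsingleton.elim _ _)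

def ExtV (A : Type) [CommRing A] (M : Type) [AddCommGroup M] [Module A M] : Prop :=
  ∀ n : ℕ, Subsingleton (Abelian.Ext (ModuleCat.of A M) (ModuleCat.of A A) (n+1))

theorem isGP_iff (A : Type) [CommRing A] (M : Type) [AddCommGroup M] [Module A M] :
    IsGP A M ↔ Function.Bijective (Module.Dual.eval A M) ∧ ExtV A M ∧
      ExtV A (Module.Dual A M) := by
  have key : ∀ (N : Type) [AddCommGroup N] [Module A N], ExtV A N ↔ (∀ i : ℕ, 0 < i →
    Subsingleton (((Ext A (ModuleCat A) i).obj
      (Opposite.op (ModuleCat.of A N))).obj (ModuleCat.of A A))) := by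
    intro N _ _
    constructor
    · intro h i hi
      obtain ⟨n, rfl⟩ : ∃ n, i = n + 1 := ⟨i - 1, by omega⟩
      exact (ext_bridge A _ _ n).2 (h n)
    · intro h n
      exact (ext_bridge A _ _ n).1 (h (n+1) n.succ_pos)
  rw [key, key]
  rfl

section
variable {A : Type} [CommRing A] {K E Q : Type} [AddCommGroup K] [Module A K]
  [AddCommGroup E] [Module A E] [AddCommGroup Q] [Module A Q]

theorem ses {j : K →ₗ[A] E} {p : E →ₗ[A] Q} (hj : Function.Injective j)
    (hjp : Function.Exact j p) (hp : Function.Surjective p) :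
    (ShortComplex.mk (ModuleCat.ofHom j) (ModuleCat.ofHom p)
      (by ext x; exact hjp.apply_apply_eq_zero x)).ShortExact where
  exact := by
    rw [ShortComplex.ShortExact.moduleCat_exact_iff_function_exact]
    exact hjp
  mono_f := (ModuleCat.mono_iff_injective _).2 hj
  epi_g := (ModuleCat.epi_iff_surjective _).2 hp

theorem ExtV.ker {j : K →ₗ[A] E} {p : E →ₗ[A] Q} (hj : Function.Injective j)
    (hjp : Function.Exact j p) (hp : Function.Surjective p) (hE : ExtV A E) (hQ : ExtV A Q) :
    ExtV A K := by
  intro n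
  refine subsingleton_of_forall_eq 0 fun x => ?_
  obtain ⟨y, hy⟩ := Abelian.Ext.contravariant_sequence_exact₁ (ses hj hjp hp) (ModuleCat.of A A) x
    (n₁ := n + 1 + 1) (by omega) ((hQ (n+1)).elim _ _)
  have h0 : y = 0 := (hE n).elim _ _
  rw [← hy, h0, Abelian.Ext.comp_zero]

theorem ExtV.mid {j : K →ₗ[A] E} {p : E →ₗ[A] Q} (hj : Function.Injective j)
    (hjp : Function.Exact j p) (hp : Function.Surjective p) (hK : ExtV A K) (hQ : ExtV A Q) :
    ExtV A E := by
  intro n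
  refine subsingleton_of_forall_eq 0 fun x => ?_
  obtain ⟨y, hy⟩ := Abelian.Ext.contravariant_sequence_exact₂ (ses hj hjp hp) (ModuleCat.of A A) x
    ((hK n).elim _ _)
  have h0 : y = 0 := (hQ n).elim _ _
  rw [← hy, h0, Abelian.Ext.comp_zero]

theorem ExtV.dual_surj {j : K →ₗ[A] E} {p : E →ₗ[A] Q} (hj : Function.Injective j)
    (hjp : Function.Exact j p) (hp : Function.Surjective p) (hQ : ExtV A Q) :
    Function.Surjective j.dualMap := by
  intro φ
  obtain ⟨y, hy⟩ := Abelian.Ext.contravariant_sequence_exact₁ (ses hj hjp hp) (ModuleCat.of A A)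
    (Abelian.Ext.mk₀ (ModuleCat.ofHom φ)) (n₁ := 1) (by omega) ((hQ 0).elim _ _)
  rw [← Abelian.Ext.mk₀_addEquiv₀_apply y, Abelian.Ext.mk₀_comp_mk₀] at hy
  have := Abelian.Ext.homEquiv₀.symm.injective hy
  refine ⟨(Abelian.Ext.addEquiv₀ y).hom, ?_⟩
  ext x
  exact congrArg (fun t => t.hom x) this

theorem ExtV.quot {j : K →ₗ[A] E} {p : E →ₗ[A] Q} (hj : Function.Injective j)
    (hjp : Function.Exact j p) (hp : Function.Surjective p) (hK : ExtV A K) (hE : ExtV A E)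
    (hs : Function.Surjective j.dualMap) : ExtV A Q := by
  intro n
  refine subsingleton_of_forall_eq 0 fun x => ?_
  obtain ⟨y, hy⟩ := Abelian.Ext.contravariant_sequence_exact₃ (ses hj hjp hp) (ModuleCat.of A A) x
    ((hE n).elim _ _) (n₀ := n) (by omega)
  rw [← hy]
  cases n with
  | succ n =>
    have h0 : y = 0 := (hK n).elim _ _
    rw [h0, Abelian.Ext.comp_zero]
  | zero =>
    obtain ⟨ψ, hψ⟩ := hs (Abelian.Ext.addEquiv₀ y).hom
    have : Abelian.Ext.addEquiv₀ y = ModuleCat.ofHom j ≫ ModuleCat.ofHom ψ := by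
      ext x
      exact congrArg (fun t => t x) hψ.symm
    rw [← Abelian.Ext.mk₀_addEquiv₀_apply y, this, ← Abelian.Ext.mk₀_comp_mk₀]
    exact (ses hj hjp hp).extClass_comp_assoc _

theorem ExtV.of_projective [Module.Projective A Q] : ExtV A Q := fun n => by
  have : Projective (ModuleCat.of A Q) := (IsProjective.iff_projective _).1 ‹_›
  exact Abelian.Ext.subsingleton_of_projective _ _ _

theorem exact_dual {j : K →ₗ[A] E} {p : E →ₗ[A] Q}
    (hjp : Function.Exact j p) (hp : Function.Surjective p) :
    Function.Exact p.dualMap j.dualMap := by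
  intro φ
  constructor
  · intro h
    have hk : LinearMap.ker p ≤ LinearMap.ker φ := by
      intro x hx
      obtain ⟨k, rfl⟩ := (hjp x).1 hx
      exact congrArg (fun t => t k) h
    refine ⟨((LinearMap.ker p).liftQ φ hk) ∘ₗ (p.quotKerEquivOfSurjective hp).symm, ?_⟩
    ext x
    have : (p.quotKerEquivOfSurjective hp).symm (p x) = (LinearMap.ker p).mkQ x := by
      rw [LinearEquiv.symm_apply_eq]; rfl
    simp [this]
  · rintro ⟨ψ, rfl⟩
    ext x
    simp [hjp.apply_apply_eq_zero x]

theorem inj_dual {p : E →ₗ[A] Q} (hp : Function.Surjective p) : Function.Injective p.dualMap :=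
  LinearMap.dualMap_injective_of_surjective hp

theorem IsGP.ker {j : K →ₗ[A] E} {p : E →ₗ[A] Q} (hj : Function.Injective j)
    (hjp : Function.Exact j p) (hp : Function.Surjective p) (hE : IsGP A E) (hQ : IsGP A Q) :
    IsGP A K := by
  rw [isGP_iff] at *
  obtain ⟨bE, vE, wE⟩ := hE
  obtain ⟨bQ, vQ, wQ⟩ := hQ
  have hjd := ExtV.dual_surj hj hjp hp vQ
  have hex := exact_dual hjp hp
  have hpd := inj_dual hp
  have npE : ∀ x, p.dualMap.dualMap (Module.Dual.eval A E x) = Module.Dual.eval A Q (p x) :=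
    fun x => rfl
  have npK : ∀ x, j.dualMap.dualMap (Module.Dual.eval A K x) = Module.Dual.eval A E (j x) :=
    fun x => rfl
  have hpdd : Function.Surjective p.dualMap.dualMap := by
    intro t
    obtain ⟨q, rfl⟩ := bQ.2 t
    obtain ⟨e, rfl⟩ := hp q
    exact ⟨_, npE e⟩
  have hjdd := inj_dual hjd
  have hexd := exact_dual hex hjd
  refine ⟨⟨?_, ?_⟩, ExtV.ker hj hjp hp vE vQ, ExtV.quot hpd hex hjd wQ wE hpdd⟩
  · intro x y hxy
    apply hj
    apply bE.1
    rw [← npK, ← npK, hxy]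
  · intro t
    obtain ⟨e, he⟩ := bE.2 (j.dualMap.dualMap t)
    have h0 : p e = 0 := by
      apply bQ.1
      rw [← npE, he, map_zero]
      exact hexd.apply_apply_eq_zero t
    obtain ⟨k, rfl⟩ := (hjp e).1 h0
    exact ⟨k, hjdd (by rw [npK, he])⟩

theorem IsGP.of_projective [Module.Finite A Q] [Module.Projective A Q] : IsGP A Q := by
  rw [isGP_iff]
  exact ⟨Module.bijective_dual_eval A Q, ExtV.of_projective, ExtV.of_projective⟩

theorem IsGP.prod (hE : IsGP A E) (hQ : IsGP A Q) : IsGP A (E × Q) := by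
  rw [isGP_iff] at *
  obtain ⟨bE, vE, wE⟩ := hE
  obtain ⟨bQ, vQ, wQ⟩ := hQ
  have h1 : Function.Injective (LinearMap.inl A E Q) := LinearMap.inl_injective
  have h2 : Function.Exact (LinearMap.inl A E Q) (LinearMap.snd A E Q) := Function.Exact.inl_snd
  have h3 : Function.Surjective (LinearMap.snd A E Q) := LinearMap.snd_surjective
  have : Module.IsReflexive A E := ⟨bE⟩
  have : Module.IsReflexive A Q := ⟨bQ⟩
  exact ⟨Module.bijective_dual_eval A _, ExtV.mid h1 h2 h3 vE vQ,
    ExtV.mid (inj_dual h3) (exact_dual h2 h3) (ExtV.dual_surj h1 h2 h3 vQ) wQ wE⟩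

theorem lift_of_extV {W : Type} [AddCommGroup W] [Module A W] {j : K →ₗ[A] E} {p : E →ₗ[A] Q}
    (hj : Function.Injective j)
    (hjp : Function.Exact j p) (hp : Function.Surjective p) (hW : ExtV A W)
    [Module.Finite A K] [Module.Projective A K] (u : W →ₗ[A] Q) :
    ∃ v : W →ₗ[A] E, p ∘ₗ v = u := by
  have hz : ∀ x : Abelian.Ext (ModuleCat.of A W) (ModuleCat.of A K) 1, x = 0 := by
    intro x
    obtain ⟨n, f, hf⟩ := Module.Finite.exists_fin' A K
    obtain ⟨g, H⟩ := Module.projective_lifting_property f .id hf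
    have hid : 𝟙 (ModuleCat.of A K) = ∑ i : Fin n,
        (ModuleCat.ofHom (LinearMap.proj i ∘ₗ g) : ModuleCat.of A K ⟶ ModuleCat.of A A) ≫
          ModuleCat.ofHom (f ∘ₗ LinearMap.single A (fun _ => A) i) := by
      ext x
      have := congrArg (fun t => t x) H
      simp only [LinearMap.comp_apply, LinearMap.id_apply] at this
      rw [ModuleCat.hom_sum, LinearMap.sum_apply]
      simp only [ModuleCat.hom_comp, ModuleCat.hom_ofHom, LinearMap.comp_apply, LinearMap.proj_apply]
      rw [← map_sum]
      simp only [LinearMap.coe_single, Finset.univ_sum_single]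
      exact this.symm
    rw [← Abelian.Ext.comp_mk₀_id x, hid, Abelian.Ext.mk₀_sum, Abelian.Ext.comp_sum]
    refine Finset.sum_eq_zero fun i _ => ?_
    rw [← Abelian.Ext.mk₀_comp_mk₀, ← Abelian.Ext.comp_assoc_of_second_deg_zero]
    have h0 : x.comp (Abelian.Ext.mk₀ (ModuleCat.ofHom (LinearMap.proj i ∘ₗ g) :
      ModuleCat.of A K ⟶ ModuleCat.of A A)) (add_zero 1) = 0 := (hW 0).elim _ _
    rw [h0, Abelian.Ext.zero_comp]
  obtain ⟨y, hy⟩ := Abelian.Ext.covariant_sequence_exact₃ (ModuleCat.of A W) (ses hj hjp hp)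
    (Abelian.Ext.mk₀ (ModuleCat.ofHom u)) (n₁ := 1) (by omega) (hz _)
  rw [← Abelian.Ext.mk₀_addEquiv₀_apply y, Abelian.Ext.mk₀_comp_mk₀] at hy
  have := Abelian.Ext.homEquiv₀.symm.injective hy
  refine ⟨(Abelian.Ext.addEquiv₀ y).hom, ?_⟩
  ext x
  exact congrArg (fun t => t.hom x) this
end

theorem factor_inj {A : Type} [CommRing A] {X K E : Type} [AddCommGroup X] [Module A X]
    [AddCommGroup K] [Module A K] [AddCommGroup E] [Module A E]
    (j : K →ₗ[A] E) (hj : Function.Injective j) (φ : X →ₗ[A] E)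
    (hφ : ∀ x, ∃ k, j k = φ x) : ∃ ψ : X →ₗ[A] K, ∀ x, j (ψ x) = φ x := by
  refine ⟨(LinearEquiv.ofInjective j hj).symm.toLinearMap ∘ₗ
    φ.codRestrict (LinearMap.range j) hφ, fun x => ?_⟩
  have := (LinearEquiv.ofInjective j hj).apply_symm_apply
    (φ.codRestrict (LinearMap.range j) hφ x)
  exact congrArg Subtype.val this


/-- a short exact sequence `0 → M' → M → M'' → 0` of finitely generated
Gorenstein projective `R`-modules, together with special Gorenstein projective
precover sequences `0 → P → G → M → 0` and `0 → P'' → G'' → M'' → 0` over `S`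
(the latter a precover), fits into a commutative 3×3 diagram with exact rows and
columns; in particular one obtains a Gorenstein projective precover `G' → M'` with
projective kernel and a conflation
`0 → (P' → G') → (P'' ⊕ P → P'' ⊕ G) → (P'' → G'') → 0` in `Mon(ω, 𝒢)`. -/
theorem stmt_15 (S : Type) [CommRing S] [IsNoetherianRing S] [IsLocalRing S]
    (ω : S) (hω : ω ∈ IsLocalRing.maximalIdeal S) (hreg : ω ∈ nonZeroDivisors S)
    (M' M M'' : Type)
    [AddCommGroup M'] [Module (S ⧸ Ideal.span {ω}) M'] [Module S M']
    [IsScalarTower S (S ⧸ Ideal.span {ω}) M']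
    [AddCommGroup M] [Module (S ⧸ Ideal.span {ω}) M] [Module S M]
    [IsScalarTower S (S ⧸ Ideal.span {ω}) M]
    [AddCommGroup M''] [Module (S ⧸ Ideal.span {ω}) M''] [Module S M'']
    [IsScalarTower S (S ⧸ Ideal.span {ω}) M'']
    (hM'fin : Module.Finite (S ⧸ Ideal.span {ω}) M')
    (hM'gp : IsGP (S ⧸ Ideal.span {ω}) M')
    (hMfin : Module.Finite (S ⧸ Ideal.span {ω}) M)
    (hMgp : IsGP (S ⧸ Ideal.span {ω}) M)
    (hM''fin : Module.Finite (S ⧸ Ideal.span {ω}) M'')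
    (hM''gp : IsGP (S ⧸ Ideal.span {ω}) M'')
    (f : M' →ₗ[S ⧸ Ideal.span {ω}] M) (g : M →ₗ[S ⧸ Ideal.span {ω}] M'')
    (hf : Function.Injective f) (hfg : Function.Exact f g)
    (hg : Function.Surjective g)
    (P G P'' G'' : Type)
    [AddCommGroup P] [Module S P] [AddCommGroup G] [Module S G]
    [AddCommGroup P''] [Module S P''] [AddCommGroup G''] [Module S G'']
    (hPfin : Module.Finite S P) (hPproj : Module.Projective S P)
    (hGfin : Module.Finite S G) (hGgp : IsGP S G)
    (hP''fin : Module.Finite S P'') (hP''proj : Module.Projective S P'')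
    (hG''fin : Module.Finite S G'') (hG''gp : IsGP S G'')
    (l : P →ₗ[S] G) (π : G →ₗ[S] M)
    (hl : Function.Injective l) (hlπ : Function.Exact l π)
    (hπ : Function.Surjective π)
    (l'' : P'' →ₗ[S] G'') (π'' : G'' →ₗ[S] M'')
    (hl'' : Function.Injective l'') (hl''π'' : Function.Exact l'' π'')
    (hπ'' : Function.Surjective π'')
    (hprecover : ∀ (W : ModuleCat.{0} S), Module.Finite S W → IsGP S W →
        ∀ u : W →ₗ[S] M'', ∃ v : W →ₗ[S] G'', π'' ∘ₗ v = u) :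
    ∃ (P' G' : ModuleCat.{0} S),
      Module.Finite S P' ∧ Module.Projective S P' ∧
      Module.Finite S G' ∧ IsGP S G' ∧
      ∃ (l' : P' →ₗ[S] G') (π' : G' →ₗ[S] M') (h : G →ₗ[S] G'')
        (a : P' →ₗ[S] P'' × P) (c : G' →ₗ[S] P'' × G) (b : P'' × P →ₗ[S] P''),
        -- `h` lifts `g ∘ π` through the precover `π''`
        π'' ∘ₗ h = (g.restrictScalars S) ∘ₗ π ∧
        -- left column: `0 → P' → G' → M' → 0` is exact
        Function.Injective l' ∧ Function.Exact l' π' ∧ Function.Surjective π' ∧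
        -- top row: `0 → P' → P'' ⊕ P → P'' → 0` is exact
        Function.Injective a ∧ Function.Exact a b ∧ Function.Surjective b ∧
        -- middle row: `0 → G' → P'' ⊕ G → G'' → 0` is exact, second map `[l'' h]`
        Function.Injective c ∧ Function.Exact c (LinearMap.coprod l'' h) ∧
        Function.Surjective (LinearMap.coprod l'' h) ∧
        -- middle column: `0 → P'' ⊕ P → P'' ⊕ G → M → 0` is exact,
        -- with maps `id ⊕ l` and `[0 π]`
        Function.Injective ((LinearMap.id : P'' →ₗ[S] P'').prodMap l) ∧
        Function.Exact ((LinearMap.id : P'' →ₗ[S] P'').prodMap l)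
          (LinearMap.coprod (0 : P'' →ₗ[S] M) π) ∧
        Function.Surjective (LinearMap.coprod (0 : P'' →ₗ[S] M) π) ∧
        -- commutativity of the four squares
        ((LinearMap.id : P'' →ₗ[S] P'').prodMap l) ∘ₗ a = c ∘ₗ l' ∧
        (LinearMap.coprod l'' h) ∘ₗ ((LinearMap.id : P'' →ₗ[S] P'').prodMap l) =
          l'' ∘ₗ b ∧
        (LinearMap.coprod (0 : P'' →ₗ[S] M) π) ∘ₗ c = (f.restrictScalars S) ∘ₗ π' ∧
        π'' ∘ₗ (LinearMap.coprod l'' h) =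
          (g.restrictScalars S) ∘ₗ (LinearMap.coprod (0 : P'' →ₗ[S] M) π) ∧
        -- `π'` is a Gorenstein projective precover of `M'` (with projective kernel)
        (∀ (W : ModuleCat.{0} S), Module.Finite S W → IsGP S W →
          ∀ u : W →ₗ[S] M', ∃ v : W →ₗ[S] G', π' ∘ₗ v = u) ∧
        -- the three vertical objects are objects of `Mon(ω, 𝒢)`
        MonObj S ω l' ∧
        MonObj S ω ((LinearMap.id : P'' →ₗ[S] P'').prodMap l) ∧
        MonObj S ω l'' := by
  obtain ⟨h, hh⟩ := hprecover (ModuleCat.of S G) hGfin hGgp ((g.restrictScalars S) ∘ₗ π)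
  have hh' : ∀ x : G, π'' (h x) = g (π x) := fun x => congrArg (fun t => t x) hh
  obtain ⟨k, hk⟩ := factor_inj l'' hl'' (h ∘ₗ l) (fun x => (hl''π'' _).1 (by
    change π'' (h (l x)) = 0
    rw [hh', hlπ.apply_apply_eq_zero, map_zero]))
  have hk' : ∀ x : P, l'' (k x) = h (l x) := hk
  have hmem : ∀ z : LinearMap.ker (LinearMap.coprod l'' h), l'' z.1.1 + h z.1.2 = 0 :=
    fun z => z.2
  have hsurj : Function.Surjective (LinearMap.coprod l'' h) := by
    intro x
    obtain ⟨m, hm⟩ := hg (π'' x)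
    obtain ⟨y, rfl⟩ := hπ m
    obtain ⟨q, hq⟩ := (hl''π'' (x - h y)).1 (by rw [map_sub, hh', hm, sub_self])
    exact ⟨(q, y), by simp [hq]⟩
  obtain ⟨π', hπ'⟩ := factor_inj (f.restrictScalars S) hf
    (π ∘ₗ LinearMap.snd S P'' G ∘ₗ (LinearMap.ker (LinearMap.coprod l'' h)).subtype) (fun z => by
      refine (hfg _).1 ?_
      change g (π z.1.2) = 0
      rw [← hh', eq_neg_of_add_eq_zero_right (hmem z), map_neg,
        hl''π''.apply_apply_eq_zero, neg_zero])
  have hfπ : ∀ z : LinearMap.ker (LinearMap.coprod l'' h), f (π' z) = π z.1.2 := hπ'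
  let a : P →ₗ[S] P'' × P := LinearMap.prod (-k) LinearMap.id
  let l' : P →ₗ[S] LinearMap.ker (LinearMap.coprod l'' h) :=
    LinearMap.codRestrict _ (LinearMap.prod (-k) l) (fun x => by simp [hk'])
  let b : P'' × P →ₗ[S] P'' := LinearMap.coprod LinearMap.id k
  have hl' : Function.Injective l' := by
    intro x y hxy
    exact hl (congrArg (fun t => t.1.2) hxy)
  have hl'π' : Function.Exact l' π' := by
    intro z
    constructor
    · intro hz
      obtain ⟨x, hx⟩ := (hlπ z.1.2).1 (by rw [← hfπ, hz, map_zero])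
      refine ⟨x, Subtype.ext (Prod.ext ?_ hx)⟩
      apply hl''
      change l'' (-(k x)) = _
      rw [map_neg, hk', hx, eq_neg_of_add_eq_zero_left (hmem z)]
    · rintro ⟨x, rfl⟩
      apply hf
      rw [hfπ, map_zero]
      exact hlπ.apply_apply_eq_zero x
  have hπ's : Function.Surjective π' := by
    intro m
    obtain ⟨x, hx⟩ := hπ (f m)
    obtain ⟨q, hq⟩ := (hl''π'' (h x)).1 (by rw [hh', hx, hfg.apply_apply_eq_zero])
    refine ⟨⟨(-q, x), by simp [hq]⟩, hf ?_⟩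
    rw [hfπ]
    exact hx
  have hP''gp : IsGP S P'' := IsGP.of_projective
  have hPgp : IsGP S P := IsGP.of_projective
  have hc : Function.Exact (LinearMap.ker (LinearMap.coprod l'' h)).subtype
      (LinearMap.coprod l'' h) := LinearMap.exact_subtype_ker_map _
  have hG'gp : IsGP S (LinearMap.ker (LinearMap.coprod l'' h)) :=
    IsGP.ker (Submodule.injective_subtype _) hc hsurj (hP''gp.prod hGgp) hG''gp
  have hG'fin : Module.Finite S (LinearMap.ker (LinearMap.coprod l'' h)) := inferInstance
  have kill : ∀ (N : Type) [AddCommGroup N] [Module (S ⧸ Ideal.span {ω}) N] [Module S N]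
      [IsScalarTower S (S ⧸ Ideal.span {ω}) N] (m : N), ω • m = 0 := by
    intro N _ _ _ _ m
    have h0 : ω • (1 : S ⧸ Ideal.span {ω}) = 0 := by
      rw [Algebra.smul_def, mul_one]
      exact Ideal.Quotient.eq_zero_iff_mem.2 (Ideal.mem_span_singleton_self ω)
    rw [← one_smul (S ⧸ Ideal.span {ω}) m, ← smul_assoc, h0, zero_smul]
  have hmid : Function.Injective ((LinearMap.id : P'' →ₗ[S] P'').prodMap l) := by
    intro x y hxy
    have h1 : x.1 = y.1 := congrArg (fun t : P'' × G => t.1) hxy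
    have h2 : l x.2 = l y.2 := congrArg (fun t : P'' × G => t.2) hxy
    exact Prod.ext h1 (hl h2)
  have hmidex : Function.Exact ((LinearMap.id : P'' →ₗ[S] P'').prodMap l)
          (LinearMap.coprod (0 : P'' →ₗ[S] M) π) := by
    intro z
    constructor
    · intro hz
      obtain ⟨x, hx⟩ := (hlπ z.2).1 (by simpa using hz)
      exact ⟨(z.1, x), Prod.ext rfl hx⟩
    · rintro ⟨x, rfl⟩
      simp [hlπ.apply_apply_eq_zero]
  refine ⟨ModuleCat.of S P, ModuleCat.of S (LinearMap.ker (LinearMap.coprod l'' h)),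
    hPfin, hPproj, hG'fin, hG'gp, l', π', h, a,
    (LinearMap.ker (LinearMap.coprod l'' h)).subtype, b, hh, hl', hl'π', hπ's, ?_, ?_, ?_,
    Submodule.injective_subtype _, hc, hsurj, hmid, hmidex, ?_, ?_, ?_, ?_, ?_, ?_,
    ⟨hPfin, hG'fin, hPgp, hG'gp, hl', ?_⟩,
    ⟨inferInstance, inferInstance, hP''gp.prod hPgp, hP''gp.prod hGgp, hmid, ?_⟩,
    ⟨hP''fin, hG''fin, hP''gp, hG''gp, hl'', ?_⟩⟩
  · intro x y hxy
    exact congrArg Prod.snd hxy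
  · intro z
    constructor
    · intro hz
      refine ⟨z.2, Prod.ext ?_ rfl⟩
      exact (eq_neg_of_add_eq_zero_left hz).symm
    · rintro ⟨x, rfl⟩
      exact neg_add_cancel (k x)
  · intro x
    exact ⟨(x, 0), by simp [b]⟩
  · intro m
    obtain ⟨x, hx⟩ := hπ m
    exact ⟨(0, x), by simp [hx]⟩
  · rfl
  · refine LinearMap.ext fun x => ?_
    change l'' x.1 + h (l x.2) = l'' (x.1 + k x.2)
    rw [map_add, hk']
  · refine LinearMap.ext fun z => ?_
    change (0 : M) + π z.1.2 = f (π' z)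
    rw [zero_add, hfπ]
  · refine LinearMap.ext fun z => ?_
    change π'' (l'' z.1 + h z.2) = g (0 + π z.2)
    rw [map_add, hl''π''.apply_apply_eq_zero, hh', zero_add, zero_add]
  · intro W _ hW u
    exact lift_of_extV hl' hl'π' hπ's ((isGP_iff S W).1 hW).2.1 u
  · intro y
    exact (hl'π' _).1 (by rw [map_smul]; exact kill M' _)
  · intro y
    exact (hmidex _).1 (by rw [map_smul]; exact kill M _)
  · intro y
    exact (hl''π'' _).1 (by rw [map_smul]; exact kill M'' _)
end
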